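/- Fix an integer ℓ ≥ 1. For every integer n ≥ ℓ + 3, the total number of ℓ-valleys over all Catalan words of length n equals C(2(n-ℓ)-1, n-ℓ-3); moreover this total is 0 when 1 ≤ n < ℓ + 3. -/

import Mathlib

/-- The set of Catalan words of length `n`: words `w` over ℕ with `w 1 = 0` and
`w (i+1) ≤ w i + 1` for all `i`. -/
def CatalanWord (n : ℕ) : Set (List ℕ) :=
  {w | w.length = n ∧ w.getD 0 0 = 0 ∧
    ∀ i, i + 1 < n → w.getD (i + 1) 0 ≤ w.getD i 0 + 1}

/-- Number of `l`-valleys of `w`: occurrences of a factor `a b^l (b+1)` with `a > b`. -/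
def lValleys (l : ℕ) (w : List ℕ) : ℕ :=
  ((Finset.range w.length).filter (fun i =>
    i + l + 1 < w.length ∧
    w.getD (i + 1) 0 < w.getD i 0 ∧
    (∀ j, j < l → w.getD (i + 1 + j) 0 = w.getD (i + 1) 0) ∧
    w.getD (i + l + 1) 0 = w.getD (i + 1) 0 + 1)).card

/-- The words `w` of length `m` that may follow the letter `c` in a Catalan word. -/
def continuations : ℕ → ℕ → Finset (List ℕ)
  | 0, _ => {[]}
  | m + 1, c => (Finset.range (c + 2)).biUnion fun d => (continuations m d).image (List.cons d)

theorem mem_continuations {m c : ℕ} {w : List ℕ} :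
    w ∈ continuations m c ↔
      w.length = m ∧ ∀ i < m, (c :: w).getD (i + 1) 0 ≤ (c :: w).getD i 0 + 1 := by
  induction m generalizing c w with
  | zero => simp [continuations]
  | succ m ih =>
    simp only [continuations, Finset.mem_biUnion, Finset.mem_range, Finset.mem_image, ih]
    constructor
    · rintro ⟨d, hd, v, ⟨hv, h⟩, rfl⟩
      refine ⟨by simp [hv], fun i hi => ?_⟩
      cases i with
      | zero => simp; omega
      | succ i => simpa using h i (by omega)
    · rintro ⟨hw, h⟩
      cases w with
      | nil => simp at hw
      | cons d v =>
        refine ⟨d, ?_, v, ⟨by simpa using hw, fun i hi => ?_⟩, rfl⟩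
        · have := h 0 (by omega)
          simp at this
          omega
        · simpa using h (i + 1) (by omega)

theorem sum_continuations_succ (f : List ℕ → ℕ) (m c : ℕ) :
    ∑ w ∈ continuations (m + 1) c, f w =
      ∑ d ∈ Finset.range (c + 2), ∑ w ∈ continuations m d, f (d :: w) := by
  rw [continuations, Finset.sum_biUnion]
  · refine Finset.sum_congr rfl fun d _ => ?_
    rw [Finset.sum_image]
    intro v _ w _ h
    simpa using h
  · intro d _ e _ hde
    simp only [Function.onFun, Finset.disjoint_left, Finset.mem_image]
    rintro _ ⟨v, _, rfl⟩ ⟨w, _, h⟩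
    exact hde (by simpa using (List.cons.inj h).1.symm)

theorem catalanWord_succ (m : ℕ) :
    CatalanWord (m + 1) = ((continuations m 0).image (List.cons 0) : Finset (List ℕ)) := by
  ext w
  simp only [CatalanWord, Set.mem_ofPred_eq, Finset.coe_image, Set.mem_image, Finset.mem_coe,
    mem_continuations]
  constructor
  · rintro ⟨hw, h0, h⟩
    cases w with
    | nil => simp at hw
    | cons d v =>
      obtain rfl : d = 0 := by simpa using h0
      exact ⟨v, ⟨by simpa using hw, fun i hi => h i (by omega)⟩, rfl⟩
  · rintro ⟨v, ⟨hv, h⟩, rfl⟩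
    exact ⟨by simp [hv], by simp, fun i hi => h i (by omega)⟩

/-- The word `w` has the prefix `d^j (d+1)`. -/
def StartsWithRise (j d : ℕ) (w : List ℕ) : Prop :=
  j < w.length ∧ (∀ i < j, w.getD i 0 = d) ∧ w.getD j 0 = d + 1

instance (j d : ℕ) (w : List ℕ) : Decidable (StartsWithRise j d w) :=
  inferInstanceAs (Decidable (_ ∧ _ ∧ _))

theorem not_startsWithRise_nil (j d : ℕ) : ¬ StartsWithRise j d [] := by
  simp [StartsWithRise]

theorem startsWithRise_zero_cons (d x : ℕ) (w : List ℕ) :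
    StartsWithRise 0 d (x :: w) ↔ x = d + 1 := by
  simp [StartsWithRise]

theorem startsWithRise_succ_cons (j d x : ℕ) (w : List ℕ) :
    StartsWithRise (j + 1) d (x :: w) ↔ x = d ∧ StartsWithRise j d w := by
  simp only [StartsWithRise, List.length_cons, add_lt_add_iff_right, List.getD_cons_succ,
    Nat.forall_lt_succ_left, List.getD_cons_zero]
  tauto

theorem lValleys_singleton (l c : ℕ) : lValleys l [c] = 0 := by
  simp [lValleys]

theorem lValleys_cons_cons (j c d : ℕ) (w : List ℕ) :
    lValleys (j + 1) (c :: d :: w) =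
      (if d < c ∧ StartsWithRise j d w then 1 else 0) + lValleys (j + 1) (d :: w) := by
  simp only [lValleys, Finset.card_filter]
  rw [List.length_cons, Finset.sum_range_succ', add_comm]
  congr 1
  · refine if_congr ?_ rfl rfl
    simp only [StartsWithRise, zero_add, List.length_cons, List.getD_cons_succ,
      List.getD_cons_zero, Nat.forall_lt_succ_left, Nat.add_comm 1, add_lt_add_iff_right]
    tauto
  · refine Finset.sum_congr rfl fun i _ => if_congr ?_ rfl rfl
    have e : i + 1 + (j + 1) + 1 = i + (j + 1) + 1 + 1 := by omega
    have e' (k : ℕ) : i + 1 + 1 + k = i + 1 + k + 1 := by omega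
    simp only [e, e', List.getD_cons_succ, List.length_cons, add_lt_add_iff_right]

theorem card_continuations_succ (m c : ℕ) :
    (continuations (m + 1) c).card = ∑ d ∈ Finset.range (c + 2), (continuations m d).card := by
  simpa using sum_continuations_succ (fun _ => 1) m c

theorem card_continuations_succ_add (m c : ℕ) :
    (continuations (m + 1) c).card + (2 * m + c + 3).choose m =
      (2 * m + c + 3).choose (m + 1) := by
  induction m generalizing c with
  | zero =>
    rw [card_continuations_succ]
    simp [continuations]
  | succ m ih =>
    induction c with
    | zero =>
      have h0 := ih 0
      have h1 := ih 1
      have hs : (2 * m + 3).choose (m + 2) = (2 * m + 3).choose (m + 1) :=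
        Nat.choose_symm_of_eq_add (by omega)
      rw [card_continuations_succ, Finset.sum_range_succ, Finset.sum_range_one,
        show 2 * (m + 1) + 0 + 3 = 2 * m + 4 + 1 by omega,
        Nat.choose_succ_succ' (2 * m + 4) m, Nat.choose_succ_succ' (2 * m + 4) (m + 1),
        Nat.choose_succ_succ' (2 * m + 3) (m + 1), hs]
      have hp : (2 * m + 4).choose (m + 1) = _ := Nat.choose_succ_succ' (2 * m + 3) m
      rw [add_zero] at h0
      rw [show 2 * m + 1 + 3 = 2 * m + 4 by omega] at h1
      omega
    | succ c ihc =>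
      have h := ih (c + 2)
      have e : 2 * (m + 1) + (c + 1) + 3 = 2 * m + c + 5 + 1 := by omega
      have e1 : 2 * (m + 1) + c + 3 = 2 * m + c + 5 := by omega
      have e2 : 2 * m + (c + 2) + 3 = 2 * m + c + 5 := by omega
      rw [card_continuations_succ] at ihc
      rw [card_continuations_succ, Finset.sum_range_succ, e,
        Nat.choose_succ_succ' (2 * m + c + 5) m, Nat.choose_succ_succ' (2 * m + c + 5) (m + 1)]
      rw [e1] at ihc
      rw [e2] at h
      omega

/-- The number of words in `continuations m d` with the prefix `d^j (d+1)`. -/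
def riseCount (j m d : ℕ) : ℕ :=
  ∑ w ∈ continuations m d, if StartsWithRise j d w then 1 else 0

theorem riseCount_zero_right (j d : ℕ) : riseCount j 0 d = 0 := by
  simp [riseCount, continuations, not_startsWithRise_nil]

theorem riseCount_zero_succ (m d : ℕ) :
    riseCount 0 (m + 1) d = (continuations m (d + 1)).card := by
  rw [riseCount, sum_continuations_succ, Finset.sum_eq_single (d + 1)]
  · simp [startsWithRise_zero_cons]
  · intro x _ hx
    simp [startsWithRise_zero_cons, hx]
  · simp

theorem riseCount_succ_succ (j m d : ℕ) : riseCount (j + 1) (m + 1) d = riseCount j m d := by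
  rw [riseCount, sum_continuations_succ, Finset.sum_eq_single d]
  · simp [startsWithRise_succ_cons, riseCount]
  · intro x _ hx
    simp [startsWithRise_succ_cons, hx]
  · simp

theorem riseCount_of_le {j m : ℕ} (h : m ≤ j) (d : ℕ) : riseCount j m d = 0 := by
  induction j generalizing m with
  | zero => rw [Nat.le_zero.1 h, riseCount_zero_right]
  | succ j ih =>
    cases m with
    | zero => exact riseCount_zero_right _ _
    | succ m => rw [riseCount_succ_succ, ih (by omega)]

theorem riseCount_add (j m d : ℕ) :
    riseCount j (j + 1 + m) d = (continuations m (d + 1)).card := by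
  induction j with
  | zero => rw [zero_add, add_comm, riseCount_zero_succ]
  | succ j ih => rw [show j + 1 + 1 + m = j + 1 + m + 1 by omega, riseCount_succ_succ, ih]

/-- The total number of `l`-valleys over all words `c w` with `w` in `continuations m c`. -/
def valleyCount (l m c : ℕ) : ℕ :=
  ∑ w ∈ continuations m c, lValleys l (c :: w)

theorem valleyCount_zero (l c : ℕ) : valleyCount l 0 c = 0 := by
  simp [valleyCount, continuations, lValleys_singleton]

theorem valleyCount_succ (j m c : ℕ) :
    valleyCount (j + 1) (m + 1) c =
      ∑ d ∈ Finset.range c, riseCount j m d +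
        ∑ d ∈ Finset.range (c + 2), valleyCount (j + 1) m d := by
  rw [valleyCount, sum_continuations_succ]
  simp only [lValleys_cons_cons, Finset.sum_add_distrib, valleyCount]
  congr 1
  rw [Finset.sum_range_succ, Finset.sum_range_succ]
  simp only [lt_irrefl, false_and, if_false, Finset.sum_const_zero,
    add_zero, show ¬ c + 1 < c by omega]
  refine Finset.sum_congr rfl fun d hd => ?_
  simp [Finset.mem_range.1 hd, riseCount]

theorem valleyCount_of_le {j m : ℕ} (h : m ≤ j + 1) (c : ℕ) : valleyCount (j + 1) m c = 0 := by
  induction m generalizing c with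
  | zero => exact valleyCount_zero _ _
  | succ m ih =>
    simp [valleyCount_succ, ih (by omega), riseCount_of_le (show m ≤ j by omega)]

theorem valleyCount_add_two (j c : ℕ) : valleyCount (j + 1) (j + 2) c = c := by
  rw [valleyCount_succ]
  simp [valleyCount_of_le, riseCount_add j 0, continuations]

theorem valleyCount_add_three (j k c : ℕ) :
    valleyCount (j + 1) (j + 3 + k) c =
      c * (2 * k + c + 4).choose (k + 1) + (2 * k + c + 5).choose k := by
  induction k generalizing c with
  | zero =>
    induction c with
    | zero =>
      simp [valleyCount_succ _ (j + 2), valleyCount_add_two, Finset.sum_range_succ]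
    | succ c ihc =>
      have h := card_continuations_succ_add 0 (c + 1)
      rw [add_zero, valleyCount_succ, Finset.sum_range_succ, Finset.sum_range_succ _ (c + 2),
        valleyCount_add_two, riseCount_add j 1]
      rw [add_zero, valleyCount_succ] at ihc
      simp at h ihc ⊢
      linarith
  | succ k ih =>
    have e : j + 3 + (k + 1) = j + 3 + k + 1 := by omega
    have hr (d : ℕ) : riseCount j (j + 3 + k) d = (continuations (k + 2) (d + 1)).card := by
      rw [← riseCount_add, show j + 1 + (k + 2) = j + 3 + k by omega]
    induction c with
    | zero =>
      rw [e, valleyCount_succ, Finset.sum_range_succ, Finset.sum_range_one, ih, ih]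
      simp only [Finset.range_zero, Finset.sum_empty, mul_add, add_zero, mul_one, add_assoc,
        Nat.reduceAdd, zero_add, one_mul, zero_mul, Nat.choose_succ_succ' (2 * k + 6),
        Nat.choose_succ_succ' (2 * k + 5)]
      omega
    | succ c ihc =>
      have h := card_continuations_succ_add (k + 1) (c + 1)
      rw [e, valleyCount_succ] at ihc ⊢
      rw [Finset.sum_range_succ, Finset.sum_range_succ _ (c + 2), ih, hr]
      rw [show 2 * (k + 1) + (c + 1) + 3 = 2 * k + c + 6 by omega] at h
      rw [show 2 * (k + 1) + c + 4 = 2 * k + c + 6 by omega,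
        show 2 * (k + 1) + c + 5 = 2 * k + c + 7 by omega] at ihc
      rw [show 2 * k + (c + 2) + 4 = 2 * k + c + 6 by omega,
        show 2 * k + (c + 2) + 5 = 2 * k + c + 7 by omega,
        show 2 * (k + 1) + (c + 1) + 4 = 2 * k + c + 6 + 1 by omega,
        show 2 * (k + 1) + (c + 1) + 5 = 2 * k + c + 7 + 1 by omega,
        Nat.choose_succ_succ' (2 * k + c + 6), Nat.choose_succ_succ' (2 * k + c + 7)]
      linarith

theorem finsum_lValleys (l m : ℕ) :
    ∑ᶠ w ∈ CatalanWord (m + 1), lValleys l w = valleyCount l m 0 := by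
  rw [catalanWord_succ, finsum_mem_coe_finset, Finset.sum_image, valleyCount]
  intro v _ w _ h
  simpa using h

/-- For fixed `l ≥ 1`, the total number of `l`-valleys over all Catalan words of
length `n` equals `C(2(n-l)-1, n-l-3)` for `n ≥ l+3`, and is `0` for `1 ≤ n < l+3`. -/
theorem total_lValleys (l : ℕ) (hl : 1 ≤ l) :
    (∀ n : ℕ, l + 3 ≤ n →
      ∑ᶠ w ∈ CatalanWord n, lValleys l w =
        Nat.choose (2 * (n - l) - 1) (n - l - 3)) ∧
    (∀ n : ℕ, 1 ≤ n → n < l + 3 →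
      ∑ᶠ w ∈ CatalanWord n, lValleys l w = 0) := by
  obtain ⟨j, rfl⟩ := Nat.exists_eq_add_of_le' hl
  constructor
  · intro n hn
    obtain ⟨k, rfl⟩ := Nat.exists_eq_add_of_le hn
    rw [show j + 1 + 3 + k = j + 3 + k + 1 by omega, finsum_lValleys, valleyCount_add_three,
      show 2 * (j + 3 + k + 1 - (j + 1)) - 1 = 2 * k + 0 + 5 by omega,
      show j + 3 + k + 1 - (j + 1) - 3 = k by omega, zero_mul, zero_add]
  · intro n h1 hn
    obtain ⟨m, rfl⟩ := Nat.exists_eq_add_of_le' h1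
    rw [finsum_lValleys]
    rcases Nat.lt_or_ge m (j + 2) with h | h
    · exact valleyCount_of_le (by omega) 0
    · rw [show m = j + 2 by omega, valleyCount_add_two]
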